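/- arXiv:1811.12226 — 2 statements merged into one kernel-verified Lean document; each statement's English description precedes it below -/
import Mathlib

section
/- Let G be a finite group. Then the rational group algebra ℚG has the 2×2 matrix algebra M₂(ℚ) as an epimorphic image (i.e. there exists a surjective ℚ-algebra homomorphism from ℚG onto M₂(ℚ)) if and only if G has the dihedral group D₈ of order 8 or the symmetric group S₃ as an epimorphic image (i.e. there exists a surjective group homomorphism from G onto D₈ or onto S₃). -/
namespace DihedralGroup

variable {n : ℕ} [NeZero n] {K : Type*} [Group K] {c s : K}

theorem pow_val_add (hc : c ^ n = 1) (i j : ZMod n) :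
    c ^ (i + j).val = c ^ i.val * c ^ j.val := by
  rw [← pow_add, ZMod.val_add, ← pow_eq_pow_mod _ hc]

theorem pow_val_sub (hc : c ^ n = 1) (i j : ZMod n) :
    c ^ (i - j).val = (c ^ j.val)⁻¹ * c ^ i.val := by
  rw [eq_inv_mul_iff_mul_eq, ← pow_val_add hc, add_sub_cancel]

/-- The homomorphism out of a dihedral group determined by the images `c` of the rotation `r 1`
and `s` of the reflection `sr 0`. -/
def lift (hc : c ^ n = 1) (hs : s * s = 1) (hcs : s * c * (s * c) = 1) :
    DihedralGroup n →* K where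
  toFun
    | r i => c ^ i.val
    | sr i => s * c ^ i.val
  map_one' := by simp only [one_def, ZMod.val_zero, pow_zero]
  map_mul' := by
    have hinv : s⁻¹ = s := inv_eq_of_mul_eq_one_left hs
    have hconj : s * c * s⁻¹ = c⁻¹ := by
      rw [hinv, eq_inv_iff_mul_eq_one, mul_assoc (s * c), hcs]
    have hpow (k : ℕ) : c ^ k * s = s * (c ^ k)⁻¹ := by
      rw [← inv_pow, ← hconj, conj_pow, hinv, mul_assoc s, ← mul_assoc s s, hs, one_mul]
    rintro (i | i) (j | j)
    · simp [r_mul_r, pow_val_add hc]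
    · simp [r_mul_sr, pow_val_sub hc, ← mul_assoc, hpow]
    · simp [sr_mul_r, pow_val_add hc, mul_assoc]
    · simp only [sr_mul_sr, pow_val_sub hc]
      rw [mul_assoc s, ← mul_assoc _ s, hpow, ← mul_assoc, ← mul_assoc, hs, one_mul]

theorem lift_r (hc : c ^ n = 1) (hs : s * s = 1) (hcs : s * c * (s * c) = 1) (i : ZMod n) :
    lift hc hs hcs (r i) = c ^ i.val := rfl

theorem lift_sr (hc : c ^ n = 1) (hs : s * s = 1) (hcs : s * c * (s * c) = 1) (i : ZMod n) :
    lift hc hs hcs (sr i) = s * c ^ i.val := rfl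

theorem exists_mulEquiv (hc : orderOf c = n) (hs : s * s = 1) (hcs : s * c * (s * c) = 1)
    (hsc : s ∉ Subgroup.zpowers c)
    (hK : ∀ g, g ∈ Subgroup.zpowers c ∨ s * g ∈ Subgroup.zpowers c) :
    Nonempty (DihedralGroup n ≃* K) := by
  have hcn : c ^ n = 1 := hc ▸ pow_orderOf_eq_one c
  have hfin : IsOfFinOrder c := orderOf_pos_iff.1 (hc ▸ NeZero.pos n)
  have hmem {g : K} (hg : g ∈ Subgroup.zpowers c) : ∃ i : ZMod n, c ^ i.val = g := by
    obtain ⟨k, rfl⟩ := hfin.mem_powers_iff_mem_zpowers.2 hg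
    refine ⟨k, ?_⟩
    rw [ZMod.val_natCast, ← pow_eq_pow_mod _ hcn]
  refine ⟨MulEquiv.ofBijective (lift hcn hs hcs) ⟨?_, fun g ↦ ?_⟩⟩
  · rw [injective_iff_map_eq_one]
    rintro (i | i) h
    · rw [lift_r, ← orderOf_dvd_iff_pow_eq_one, hc] at h
      rw [(ZMod.val_eq_zero i).1 (Nat.eq_zero_of_dvd_of_lt h i.val_lt), r_zero]
    · rw [lift_sr, mul_eq_one_iff_eq_inv] at h
      exact absurd (h ▸ inv_mem (pow_mem (Subgroup.mem_zpowers c) _)) hsc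
  · rcases hK g with h | h
    · obtain ⟨i, hi⟩ := hmem h
      exact ⟨r i, hi⟩
    · obtain ⟨i, hi⟩ := hmem h
      exact ⟨sr i, by rw [lift_sr, hi, ← mul_assoc, hs, one_mul]⟩

theorem mulEquiv_perm_fin_three : Nonempty (DihedralGroup 3 ≃* Equiv.Perm (Fin 3)) := by
  let f : DihedralGroup 3 →* Equiv.Perm (Fin 3) :=
    lift (c := finRotate 3) (s := Equiv.swap 0 1) (by decide) (by decide) (by decide)
  have hf : Function.Injective f := by
    rw [injective_iff_map_eq_one]
    rintro (i | i) <;> revert i <;> decide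
  exact ⟨MulEquiv.ofBijective f ((Fintype.bijective_iff_injective_and_card f).2
    ⟨hf, by rw [card, Fintype.card_perm]; rfl⟩)⟩

theorem exists_surjective_six_three :
    ∃ f : DihedralGroup 6 →* DihedralGroup 3, Function.Surjective f := by
  refine ⟨lift (c := r 1) (s := sr 0) (by decide) (by decide) (by decide), ?_⟩
  rintro (i | i)
  · refine ⟨r (i.val : ℕ), ?_⟩
    rw [lift_r]; revert i; decide
  · refine ⟨sr (i.val : ℕ), ?_⟩
    rw [lift_sr]; revert i; decide

end DihedralGroup
open scoped Matrix

theorem Matrix.mul_self_fin_two (M : Matrix (Fin 2) (Fin 2) ℚ) :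
    M * M = M.trace • M - M.det • 1 := by
  ext i j
  fin_cases i <;> fin_cases j <;>
    simp [Matrix.mul_apply, Matrix.trace_fin_two, Matrix.det_fin_two] <;> ring

theorem Matrix.trace_mul_self_fin_two (M : Matrix (Fin 2) (Fin 2) ℚ) :
    (M * M).trace = M.trace ^ 2 - 2 * M.det := by
  simp [Matrix.mul_apply, Matrix.trace_fin_two, Matrix.det_fin_two]
  ring

theorem Rat.sq_ne_three (x : ℚ) : x ^ 2 ≠ 3 := by
  intro h
  have h1 : IsSquare (3 : ℚ) := ⟨x, by rw [← h, pow_two]⟩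
  revert h1
  decide +kernel

section Representation

variable {H : Type*} [Group H] [Finite H] (ρ : H →* Matrix (Fin 2) (Fin 2) ℚ)

theorem det_eq_one_or_neg_one (h : H) : (ρ h).det = 1 ∨ (ρ h).det = -1 := by
  have h1 : (ρ h).det ^ Nat.card H = 1 := by
    rw [← Matrix.det_pow, ← map_pow, pow_card_eq_one', map_one, Matrix.det_one]
  rw [← abs_eq zero_le_one]
  rw [← pow_eq_one_iff_of_nonneg (abs_nonneg _) (Nat.card_pos (α := H)).ne', ← abs_pow, h1,
    abs_one]

omit [Finite H] in
theorem trace_mul_self_of_det_eq_one {h : H} (hd : (ρ h).det = 1) :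
    (ρ (h * h)).trace = (ρ h).trace ^ 2 - 2 := by
  rw [map_mul, Matrix.trace_mul_self_fin_two, hd, mul_one]

omit [Finite H] in
theorem det_mul_self_of_det_eq_one {h : H} (hd : (ρ h).det = 1) : (ρ (h * h)).det = 1 := by
  rw [map_mul, Matrix.det_mul, hd, mul_one]

theorem den_trace_eq_one {h : H} (hd : (ρ h).det = 1) : (ρ h).trace.den = 1 := by
  have : Nonempty {h : H // (ρ h).det = 1} := ⟨⟨h, hd⟩⟩
  obtain ⟨⟨m, hm⟩, hmax⟩ :=
    Finite.exists_max fun h : {h : H // (ρ h).det = 1} ↦ (ρ h).trace.den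
  have h1 := hmax ⟨m * m, det_mul_self_of_det_eq_one ρ hm⟩
  have h2 : ((ρ m).trace ^ 2 - 2).den = (ρ m).trace.den ^ 2 := by
    have := Rat.sub_intCast_den ((ρ m).trace * (ρ m).trace) 2
    rw [Rat.mul_self_den] at this
    rw [pow_two, pow_two]
    exact_mod_cast this
  simp only [trace_mul_self_of_det_eq_one ρ hm, h2] at h1
  have h3 := hmax ⟨h, hd⟩
  have h4 := (ρ m).trace.den_pos
  have h5 := (ρ h).trace.den_pos
  simp only at h3
  nlinarith

theorem abs_trace_le_two {h : H} (hd : (ρ h).det = 1) : |(ρ h).trace| ≤ 2 := by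
  have : Nonempty {h : H // (ρ h).det = 1} := ⟨⟨h, hd⟩⟩
  obtain ⟨⟨m, hm⟩, hmax⟩ :=
    Finite.exists_max fun h : {h : H // (ρ h).det = 1} ↦ |(ρ h).trace|
  have h1 := hmax ⟨m * m, det_mul_self_of_det_eq_one ρ hm⟩
  simp only [trace_mul_self_of_det_eq_one ρ hm, ← sq_abs (ρ m).trace] at h1
  have h2 := (le_abs_self _).trans h1
  have h3 := hmax ⟨h, hd⟩
  simp only at h3
  nlinarith [abs_nonneg (ρ m).trace]

theorem trace_mem {h : H} (hd : (ρ h).det = 1) :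
    (ρ h).trace = -2 ∨ (ρ h).trace = -1 ∨ (ρ h).trace = 0 ∨ (ρ h).trace = 1 ∨
      (ρ h).trace = 2 := by
  have h1 := abs_le.1 (abs_trace_le_two ρ hd)
  rw [← Rat.coe_int_num_of_den_eq_one (den_trace_eq_one ρ hd)] at h1 ⊢
  generalize (ρ h).trace.num = z at h1 ⊢
  norm_cast at h1 ⊢
  omega

variable {ρ} (hρ : Function.Injective ρ)
include hρ

theorem eq_one_of_trace_eq_two {h : H} (hd : (ρ h).det = 1) (ht : (ρ h).trace = 2) : h = 1 := by
  have hsq := Matrix.mul_self_fin_two (ρ h)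
  rw [hd, ht, one_smul] at hsq
  have hpow (k : ℕ) : ρ h ^ k = 1 + (k : ℚ) • (ρ h - 1) := by
    induction k with
    | zero => simp
    | succ k ih =>
      rw [pow_succ, ih, add_mul, one_mul, smul_mul_assoc, sub_mul, hsq, one_mul]
      push_cast
      module
  have h1 := hpow (Nat.card H)
  rw [← map_pow, pow_card_eq_one', map_one, left_eq_add, smul_eq_zero, sub_eq_zero] at h1
  have h2 : ((Nat.card H : ℕ) : ℚ) ≠ 0 := mod_cast Nat.card_pos.ne'
  exact hρ ((h1.resolve_left h2).trans (map_one ρ).symm)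

theorem eq_neg_one_of_trace_eq_neg_two {h : H} (hd : (ρ h).det = 1)
    (ht : (ρ h).trace = -2) : ρ h = -1 := by
  have hsq := Matrix.mul_self_fin_two (ρ h)
  have h1 : h * h = 1 := eq_one_of_trace_eq_two hρ (det_mul_self_of_det_eq_one ρ hd) (by
    rw [trace_mul_self_of_det_eq_one ρ hd, ht]; norm_num)
  rw [← map_mul, h1, hd, ht, map_one] at hsq
  linear_combination (norm := module) (1 / 2 : ℚ) • hsq

theorem mul_self_eq_one_of_det_eq_neg_one {h : H} (hd : (ρ h).det = -1) : h * h = 1 := by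
  have hd2 : (ρ (h * h)).det = 1 := by rw [map_mul, Matrix.det_mul, hd]; norm_num
  have ht : (ρ (h * h)).trace = (ρ h).trace ^ 2 + 2 := by
    rw [map_mul, Matrix.trace_mul_self_fin_two, hd]; ring
  refine eq_one_of_trace_eq_two hρ hd2 ?_
  nlinarith [abs_le.1 (abs_trace_le_two ρ hd2), sq_nonneg (ρ h).trace]

omit hρ in
variable (ρ) in
theorem exists_invariant_form : ∃ P : Matrix (Fin 2) (Fin 2) ℚ, 0 < P 0 0 ∧ P 0 1 = P 1 0 ∧
    ∀ h, (ρ h)ᵀ * P * ρ h = P := by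
  have := Fintype.ofFinite H
  refine ⟨∑ h, (ρ h)ᵀ * ρ h, ?_, ?_, fun h ↦ ?_⟩
  · rw [Matrix.sum_apply]
    refine Finset.sum_pos' (fun h _ ↦ ?_) ⟨1, Finset.mem_univ _, ?_⟩
    · simp [Matrix.mul_apply]; nlinarith
    · simp
  · simp only [Matrix.sum_apply]
    refine Finset.sum_congr rfl fun h _ ↦ ?_
    simp [Matrix.mul_apply]; ring
  · conv_rhs => rw [← Equiv.sum_comp (Equiv.mulRight h)]
    rw [Finset.mul_sum, Finset.sum_mul]
    refine Finset.sum_congr rfl fun g _ ↦ ?_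
    simp [Matrix.mul_assoc]

omit hρ in
variable (ρ) in
/-- The matrices of determinant one in a finite group are contained in a plane of commuting
matrices. -/
theorem exists_rotation_plane : ∃ u v : ℚ, ∀ h, (ρ h).det = 1 →
    (ρ h) 1 1 = (ρ h) 0 0 + u * (ρ h) 1 0 ∧ (ρ h) 0 1 = v * (ρ h) 1 0 := by
  obtain ⟨P, hP, hs, hinv⟩ := exists_invariant_form ρ
  refine ⟨2 * P 0 1 / P 0 0, -(P 1 1 / P 0 0), fun h hd ↦ ?_⟩
  have h1 : (ρ h)ᵀ * P = P * (ρ h).adjugate := by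
    conv_rhs => rw [← hinv h]
    rw [mul_assoc, Matrix.mul_adjugate, hd, one_smul, mul_one]
  have e00 := congr_fun₂ h1 0 0
  have e11 := congr_fun₂ h1 1 0
  simp [Matrix.mul_apply, Matrix.adjugate_fin_two, Fin.sum_univ_two] at e00 e11
  rw [← hs] at e00 e11
  constructor <;> field_simp <;> linarith

theorem commute_of_det_eq_one {g h : H} (hg : (ρ g).det = 1) (hh : (ρ h).det = 1) :
    g * h = h * g := by
  obtain ⟨u, v, huv⟩ := exists_rotation_plane ρ
  obtain ⟨g1, g2⟩ := huv g hg
  obtain ⟨h1, h2⟩ := huv h hh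
  apply hρ
  rw [map_mul, map_mul]
  ext i j
  fin_cases i <;> fin_cases j <;> simp [Matrix.mul_apply, g1, g2, h1, h2] <;> ring

omit hρ in
theorem exists_eq_smul_one_add_smul {c d : H} (hc : (ρ c).det = 1) (hct : (ρ c).trace ^ 2 ≠ 4)
    (hd : (ρ d).det = 1) : ∃ a b : ℚ, ρ d = a • 1 + b • ρ c := by
  obtain ⟨u, v, huv⟩ := exists_rotation_plane ρ
  obtain ⟨c1, c2⟩ := huv c hc
  obtain ⟨d1, d2⟩ := huv d hd
  have h0 : ρ c 1 0 ≠ 0 := by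
    rintro h0
    rw [Matrix.det_fin_two, c1, c2, h0] at hc
    rw [Matrix.trace_fin_two, c1, h0] at hct
    exact hct (by linear_combination 4 * hc)
  refine ⟨ρ d 0 0 - ρ d 1 0 / ρ c 1 0 * ρ c 0 0, ρ d 1 0 / ρ c 1 0, ?_⟩
  ext i j
  fin_cases i <;> fin_cases j <;> simp [c1, c2, d1, d2] <;> field_simp
  ring

omit [Finite H] hρ in
theorem four_eq_of_eq_smul_one_add_smul {c d : H} (hc : (ρ c).det = 1) (hd : (ρ d).det = 1)
    {a b : ℚ} (h : ρ d = a • 1 + b • ρ c) :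
    (ρ d).trace = 2 * a + b * (ρ c).trace ∧
      (ρ d).trace ^ 2 + b ^ 2 * (4 - (ρ c).trace ^ 2) = 4 := by
  rw [Matrix.det_fin_two] at hc hd
  simp only [h, Matrix.trace_fin_two, Matrix.add_apply, Matrix.smul_apply, smul_eq_mul,
    Matrix.one_apply_eq, Matrix.one_apply, Fin.isValue, zero_ne_one, one_ne_zero, if_false] at hd ⊢
  constructor
  · ring
  · linear_combination 4 * hd - 4 * b ^ 2 * hc

theorem mem_zpowers_of_trace_eq_zero {c d : H} (hc : (ρ c).det = 1) (hct : (ρ c).trace = 0)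
    (hd : (ρ d).det = 1) : d ∈ Subgroup.zpowers c := by
  obtain ⟨a, b, hab⟩ := exists_eq_smul_one_add_smul hc (by rw [hct]; norm_num) hd
  obtain ⟨h1, h2⟩ := four_eq_of_eq_smul_one_add_smul hc hd hab
  have hsq := Matrix.mul_self_fin_two (ρ c)
  rw [hc, hct, zero_smul, one_smul, zero_sub] at hsq
  have key : ∃ k : ℕ, d = c ^ k := by
    simp only [← hρ.eq_iff, map_pow, hab]
    rw [hct] at h1 h2
    have h3 : (ρ d).trace ^ 2 ≠ 1 := fun h ↦
      Rat.sq_ne_three (2 * b) (by linear_combination h2 - h)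
    have h4 : (a = 0 ∧ (b = 1 ∨ b = -1)) ∨ ((a = 1 ∨ a = -1) ∧ b = 0) := by
      rcases trace_mem ρ hd with h | h | h | h | h
      · refine .inr ⟨.inr (by linarith), by rw [h] at h2; nlinarith⟩
      · simp [h] at h3
      · refine .inl ⟨by linarith, sq_eq_one_iff.1 (by rw [h] at h2; linarith)⟩
      · simp [h] at h3
      · refine .inr ⟨.inl (by linarith), by rw [h] at h2; nlinarith⟩
    rcases h4 with ⟨rfl, rfl | rfl⟩ | ⟨rfl | rfl, rfl⟩
    · exact ⟨1, by simp⟩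
    · exact ⟨3, by simp [pow_succ, hsq]⟩
    · exact ⟨0, by simp⟩
    · exact ⟨2, by simp [pow_succ, hsq]⟩
  obtain ⟨k, rfl⟩ := key
  exact pow_mem (Subgroup.mem_zpowers c) k

theorem mem_zpowers_of_trace_eq_one {c d : H} (hc : (ρ c).det = 1) (hct : (ρ c).trace = 1)
    (hd : (ρ d).det = 1) : d ∈ Subgroup.zpowers c := by
  obtain ⟨a, b, hab⟩ := exists_eq_smul_one_add_smul hc (by rw [hct]; norm_num) hd
  obtain ⟨h1, h2⟩ := four_eq_of_eq_smul_one_add_smul hc hd hab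
  have hsq := Matrix.mul_self_fin_two (ρ c)
  rw [hc, hct, one_smul, one_smul] at hsq
  have key : ∃ k : ℕ, d = c ^ k := by
    simp only [← hρ.eq_iff, map_pow, hab]
    rw [hct] at h1 h2
    have h3 : (ρ d).trace ≠ 0 := fun h ↦
      Rat.sq_ne_three (3 * b / 2) (by rw [h] at h2; linear_combination 3 / 4 * h2)
    have hb : (ρ d).trace ^ 2 = 1 → b = 1 ∨ b = -1 := fun h ↦
      sq_eq_one_iff.1 (by linarith)
    have h4 : (a = 1 ∧ b = 0) ∨ (a = -1 ∧ b = 0) ∨ (a = 0 ∧ b = 1) ∨ (a = -1 ∧ b = 1) ∨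
        (a = 0 ∧ b = -1) ∨ (a = 1 ∧ b = -1) := by
      rcases trace_mem ρ hd with h | h | h | h | h
      · have : b = 0 := by rw [h] at h2; nlinarith
        grind
      · grind
      · exact absurd h h3
      · grind
      · have : b = 0 := by rw [h] at h2; nlinarith
        grind
    rcases h4 with ⟨rfl, rfl⟩ | ⟨rfl, rfl⟩ | ⟨rfl, rfl⟩ | ⟨rfl, rfl⟩ | ⟨rfl, rfl⟩ | ⟨rfl, rfl⟩
    · exact ⟨0, by simp⟩
    · exact ⟨3, by simp [pow_succ, hsq, sub_mul]⟩
    · exact ⟨1, by simp⟩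
    · exact ⟨2, by simp [pow_succ, hsq]; abel⟩
    · exact ⟨4, by simp [pow_succ, hsq, sub_mul]⟩
    · exact ⟨5, by simp [pow_succ, hsq, sub_mul]; abel⟩
  obtain ⟨k, rfl⟩ := key
  exact pow_mem (Subgroup.mem_zpowers c) k

theorem mem_zpowers_of_trace_eq_neg_one (hone : ∀ d, (ρ d).det = 1 → (ρ d).trace ≠ 1)
    {c d : H} (hc : (ρ c).det = 1) (hct : (ρ c).trace = -1)
    (hd : (ρ d).det = 1) : d ∈ Subgroup.zpowers c := by
  obtain ⟨a, b, hab⟩ := exists_eq_smul_one_add_smul hc (by rw [hct]; norm_num) hd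
  obtain ⟨h1, h2⟩ := four_eq_of_eq_smul_one_add_smul hc hd hab
  have hsq := Matrix.mul_self_fin_two (ρ c)
  rw [hc, hct, neg_smul, one_smul, one_smul] at hsq
  have key : ∃ k : ℕ, d = c ^ k := by
    simp only [← hρ.eq_iff, map_pow, hab]
    rw [hct] at h1 h2
    have h3 : (ρ d).trace ≠ 0 := fun h ↦
      Rat.sq_ne_three (3 * b / 2) (by rw [h] at h2; linear_combination 3 / 4 * h2)
    have h4 : (a = 1 ∧ b = 0) ∨ (a = 0 ∧ b = 1) ∨ (a = -1 ∧ b = -1) := by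
      rcases trace_mem ρ hd with h | h | h | h | h
      · have hneg := eq_neg_one_of_trace_eq_neg_two hρ hd h
        refine absurd ?_ (hone (d * c) (by rw [map_mul, Matrix.det_mul, hc, hd, one_mul]))
        rw [map_mul, hneg, neg_one_mul, Matrix.trace_neg, hct, neg_neg]
      · grind
      · exact absurd h h3
      · exact absurd h (hone d hd)
      · have : b = 0 := by rw [h] at h2; nlinarith
        grind
    rcases h4 with ⟨rfl, rfl⟩ | ⟨rfl, rfl⟩ | ⟨rfl, rfl⟩
    · exact ⟨0, by simp⟩
    · exact ⟨1, by simp⟩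
    · exact ⟨2, by simp [pow_succ, hsq]; abel⟩
  obtain ⟨k, rfl⟩ := key
  exact pow_mem (Subgroup.mem_zpowers c) k

omit [Finite H] in
theorem orderOf_eq_four {c : H} (hc : (ρ c).det = 1) (hct : (ρ c).trace = 0) :
    orderOf c = 4 := by
  have hsq := Matrix.mul_self_fin_two (ρ c)
  rw [hc, hct, zero_smul, one_smul, zero_sub] at hsq
  refine orderOf_eq_prime_pow (p := 2) (n := 1) ?_ ?_
  · rw [← hρ.eq_iff]
    intro h
    have := congr_fun₂ h 0 0
    norm_num [pow_succ, hsq] at this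
  · rw [← hρ.eq_iff]
    simp [pow_succ, hsq]

omit [Finite H] in
theorem orderOf_eq_three {c : H} (hc : (ρ c).det = 1) (hct : (ρ c).trace = -1) :
    orderOf c = 3 := by
  have hsq := Matrix.mul_self_fin_two (ρ c)
  rw [hc, hct, neg_smul, one_smul, one_smul] at hsq
  refine orderOf_eq_prime ?_ ?_
  · rw [← hρ.eq_iff]
    simp [pow_succ, hsq, sub_mul]
  · rintro rfl
    norm_num [Matrix.trace_fin_two] at hct

omit [Finite H] in
theorem orderOf_eq_six {c : H} (hc : (ρ c).det = 1) (hct : (ρ c).trace = 1) :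
    orderOf c = 6 := by
  have hsq := Matrix.mul_self_fin_two (ρ c)
  rw [hc, hct, one_smul, one_smul] at hsq
  have h3 : ρ (c ^ 3) = -1 := by simp [pow_succ, hsq, sub_mul]
  have h2 : c ^ 2 ≠ 1 := by
    rw [pow_two]
    intro h
    have := trace_mul_self_of_det_eq_one ρ hc
    rw [h, hct, map_one] at this
    norm_num [Matrix.trace_fin_two] at this
  refine orderOf_eq_of_pow_and_pow_div_prime (by norm_num) ?_ fun p hp hdvd ↦ ?_
  · rw [← hρ.eq_iff, show 6 = 3 * 2 by rfl, pow_mul, map_pow, h3]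
    simp
  · have hp' : p = 2 ∨ p = 3 := by
      have := (Nat.Prime.dvd_mul hp).1 (show p ∣ 2 * 3 from hdvd)
      simpa [Nat.prime_dvd_prime_iff_eq hp, Nat.prime_two, Nat.prime_three] using this
    rcases hp' with rfl | rfl
    · intro h
      rw [show 6 / 2 = 3 by rfl] at h
      rw [h, map_one] at h3
      have := congr_fun₂ h3 0 0
      norm_num at this
    · exact h2

theorem exists_generator_of_rotations {c : H} (hc : (ρ c).det = 1) (hcc : c * c ≠ 1) :
    ∃ g : H, (orderOf g = 3 ∨ orderOf g = 4 ∨ orderOf g = 6) ∧ (ρ g).det = 1 ∧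
      ∀ d, (ρ d).det = 1 → d ∈ Subgroup.zpowers g := by
  by_cases hone : ∃ d, (ρ d).det = 1 ∧ (ρ d).trace = 1
  · obtain ⟨d, hd, hdt⟩ := hone
    exact ⟨d, .inr (.inr (orderOf_eq_six hρ hd hdt)), hd,
      fun _ ↦ mem_zpowers_of_trace_eq_one hρ hd hdt⟩
  push Not at hone
  refine ⟨c, ?_⟩
  rcases trace_mem ρ hc with h | h | h | h | h
  · refine absurd (hρ ?_) hcc
    rw [map_mul, eq_neg_one_of_trace_eq_neg_two hρ hc h, map_one, neg_one_mul, neg_neg]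
  · exact ⟨.inl (orderOf_eq_three hρ hc h), hc,
      fun _ ↦ mem_zpowers_of_trace_eq_neg_one hρ hone hc h⟩
  · exact ⟨.inr (.inl (orderOf_eq_four hρ hc h)), hc,
      fun _ ↦ mem_zpowers_of_trace_eq_zero hρ hc h⟩
  · exact absurd h (hone c hc)
  · exact absurd (by rw [eq_one_of_trace_eq_two hρ hc h, one_mul]) hcc

theorem nonempty_dihedralGroup_mulEquiv (hcomm : ∃ g h : H, g * h ≠ h * g) :
    Nonempty (DihedralGroup 3 ≃* H) ∨ Nonempty (DihedralGroup 4 ≃* H) ∨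
      Nonempty (DihedralGroup 6 ≃* H) := by
  obtain ⟨x, y, hxy⟩ := hcomm
  obtain ⟨s, hs⟩ : ∃ s, (ρ s).det = -1 := by
    by_contra! hs
    exact hxy (commute_of_det_eq_one hρ ((det_eq_one_or_neg_one ρ x).resolve_right (hs x))
      ((det_eq_one_or_neg_one ρ y).resolve_right (hs y)))
  obtain ⟨c₀, hc₀, hcc₀⟩ : ∃ c, (ρ c).det = 1 ∧ c * c ≠ 1 := by
    by_contra! hc
    have hsq (g : H) : g * g = 1 :=
      (det_eq_one_or_neg_one ρ g).elim (hc g) (mul_self_eq_one_of_det_eq_neg_one hρ)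
    have hinv (g : H) : g⁻¹ = g := inv_eq_of_mul_eq_one_left (hsq g)
    exact hxy (by rw [← hinv (x * y), mul_inv_rev, hinv, hinv])
  obtain ⟨c, hord, hc, hgen⟩ := exists_generator_of_rotations hρ hc₀ hcc₀
  have hss : s * s = 1 := mul_self_eq_one_of_det_eq_neg_one hρ hs
  have hcs : s * c * (s * c) = 1 := mul_self_eq_one_of_det_eq_neg_one hρ (by
    rw [map_mul, Matrix.det_mul, hs, hc, mul_one])
  have hsc : s ∉ Subgroup.zpowers c := by
    rw [← mem_powers_iff_mem_zpowers]
    rintro ⟨k, rfl⟩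
    norm_num [hc] at hs
  have hK (g : H) : g ∈ Subgroup.zpowers c ∨ s * g ∈ Subgroup.zpowers c := by
    refine (det_eq_one_or_neg_one ρ g).imp (hgen g) fun h ↦ hgen _ ?_
    rw [map_mul, Matrix.det_mul, hs, h]
    norm_num
  rcases hord with h | h | h
  · exact .inl (DihedralGroup.exists_mulEquiv h hss hcs hsc hK)
  · exact .inr (.inl (DihedralGroup.exists_mulEquiv h hss hcs hsc hK))
  · exact .inr (.inr (DihedralGroup.exists_mulEquiv h hss hcs hsc hK))

end Representation

theorem exists_not_commute_of_surjective {G : Type*} [Group G]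
    {f : MonoidAlgebra ℚ G →ₐ[ℚ] Matrix (Fin 2) (Fin 2) ℚ} (hf : Function.Surjective f) :
    ∃ g h : G, ¬ Commute (f (.of ℚ G g)) (f (.of ℚ G h)) := by
  by_contra! hcomm
  have h1 (x y : MonoidAlgebra ℚ G) : Commute (f x) (f y) := by
    induction x using MonoidAlgebra.induction_on with
    | add x x' hx hx' => rw [map_add]; exact hx.add_left hx'
    | smul r x hx => rw [map_smul]; exact hx.smul_left r
    | of g =>
      induction y using MonoidAlgebra.induction_on with
      | add y y' hy hy' => rw [map_add]; exact hy.add_right hy'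
      | smul r y hy => rw [map_smul]; exact hy.smul_right r
      | of h => exact hcomm g h
  obtain ⟨x, hx⟩ := hf !![0, 1; 0, 0]
  obtain ⟨y, hy⟩ := hf !![0, 0; 1, 0]
  have h2 := congr_fun₂ (h1 x y).eq 0 0
  simp [hx, hy] at h2


open DihedralGroup in
theorem exists_surjective_algHom_of_units {n : ℕ} [NeZero n] {G : Type*} [Group G]
    (φ : G →* DihedralGroup n) (hφ : Function.Surjective φ)
    (c s : (Matrix (Fin 2) (Fin 2) ℚ)ˣ) (hc : c ^ n = 1) (hs : s * s = 1)
    (hcs : s * c * (s * c) = 1)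
    (hspan : ∀ M : Matrix (Fin 2) (Fin 2) ℚ, ∃ x y z w : ℚ,
      M = x • 1 + y • (c : Matrix (Fin 2) (Fin 2) ℚ) + z • (s : Matrix (Fin 2) (Fin 2) ℚ) +
        w • (s * c : Matrix (Fin 2) (Fin 2) ℚ)) :
    ∃ f : MonoidAlgebra ℚ G →ₐ[ℚ] Matrix (Fin 2) (Fin 2) ℚ, Function.Surjective f := by
  let ψ := lift hc hs hcs
  let f := MonoidAlgebra.lift ℚ (Matrix (Fin 2) (Fin 2) ℚ) G ((Units.coeHom _).comp (ψ.comp φ))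
  refine ⟨f, fun M ↦ ?_⟩
  rw [← AlgHom.mem_range]
  have hmem (d : DihedralGroup n) : (ψ d : Matrix (Fin 2) (Fin 2) ℚ) ∈ f.range := by
    obtain ⟨g, rfl⟩ := hφ d
    exact ⟨MonoidAlgebra.of ℚ G g, by simp [f]⟩
  have hcmem : (c : Matrix (Fin 2) (Fin 2) ℚ) ∈ f.range := by
    have := hmem (r ((1 : ℕ) : ZMod n))
    rwa [lift_r, ZMod.val_natCast, ← pow_eq_pow_mod _ hc, pow_one] at this
  have hsmem : (s : Matrix (Fin 2) (Fin 2) ℚ) ∈ f.range := by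
    have := hmem (sr 0)
    rwa [lift_sr, ZMod.val_zero, pow_zero, mul_one] at this
  obtain ⟨x, y, z, w, rfl⟩ := hspan M
  exact add_mem (add_mem (add_mem (Subalgebra.smul_mem _ (one_mem _) _)
    (Subalgebra.smul_mem _ hcmem _)) (Subalgebra.smul_mem _ hsmem _))
    (Subalgebra.smul_mem _ (mul_mem hsmem hcmem) _)

/-- The matrix exchanging the two coordinates. -/
def swapUnit : (Matrix (Fin 2) (Fin 2) ℚ)ˣ where
  val := !![0, 1; 1, 0]
  inv := !![0, 1; 1, 0]
  val_inv := by simp [Matrix.one_fin_two]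
  inv_val := by simp [Matrix.one_fin_two]

/-- The companion matrix of `X ^ 2 - t X + 1`. -/
def rotationUnit (t : ℚ) : (Matrix (Fin 2) (Fin 2) ℚ)ˣ where
  val := !![0, -1; 1, t]
  inv := !![t, 1; -1, 0]
  val_inv := by simp [Matrix.one_fin_two]
  inv_val := by simp [Matrix.one_fin_two]

theorem exists_surjective_algHom_of_dihedralGroup_four {G : Type*} [Group G]
    (φ : G →* DihedralGroup 4) (hφ : Function.Surjective φ) :
    ∃ f : MonoidAlgebra ℚ G →ₐ[ℚ] Matrix (Fin 2) (Fin 2) ℚ, Function.Surjective f := by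
  refine exists_surjective_algHom_of_units φ hφ (rotationUnit 0) swapUnit ?_ ?_ ?_ fun M ↦
    ⟨(M 0 0 + M 1 1) / 2, (M 1 0 - M 0 1) / 2, (M 0 1 + M 1 0) / 2, (M 0 0 - M 1 1) / 2, ?_⟩
  · ext1; simp [rotationUnit, pow_succ, Matrix.one_fin_two]
  · ext1; simp [swapUnit, Matrix.one_fin_two]
  · ext1; simp [rotationUnit, swapUnit, Matrix.one_fin_two]
  · ext i j
    fin_cases i <;> fin_cases j <;> simp [rotationUnit, swapUnit] <;> ring_nf

theorem exists_surjective_algHom_of_dihedralGroup_three {G : Type*} [Group G]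
    (φ : G →* DihedralGroup 3) (hφ : Function.Surjective φ) :
    ∃ f : MonoidAlgebra ℚ G →ₐ[ℚ] Matrix (Fin 2) (Fin 2) ℚ, Function.Surjective f := by
  refine exists_surjective_algHom_of_units φ hφ (rotationUnit (-1)) swapUnit ?_ ?_ ?_ fun M ↦
    ⟨M 0 0 - (2 * (M 0 0 - M 1 1) - (M 1 0 - M 0 1)) / 3,
      (2 * (M 1 0 - M 0 1) - (M 0 0 - M 1 1)) / 3,
      M 1 0 - (2 * (M 1 0 - M 0 1) - (M 0 0 - M 1 1)) / 3,
      (2 * (M 0 0 - M 1 1) - (M 1 0 - M 0 1)) / 3, ?_⟩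
  · ext1; simp [rotationUnit, pow_succ, Matrix.one_fin_two]
  · ext1; simp [swapUnit, Matrix.one_fin_two]
  · ext1; simp [rotationUnit, swapUnit, Matrix.one_fin_two]
  · ext i j
    fin_cases i <;> fin_cases j <;> simp [rotationUnit, swapUnit] <;> ring_nf

/-- For a finite group `G`, the rational group algebra `ℚG` has `M₂(ℚ)` as an epimorphic
image if and only if `G` has `D₈` or `S₃` as an epimorphic image. -/
theorem ratGroupAlgebra_M2Q_quotient_iff (G : Type*) [Group G] [Finite G] :
    (∃ f : MonoidAlgebra ℚ G →ₐ[ℚ] Matrix (Fin 2) (Fin 2) ℚ, Function.Surjective f) ↔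
      ((∃ φ : G →* DihedralGroup 4, Function.Surjective φ) ∨
       (∃ φ : G →* Equiv.Perm (Fin 3), Function.Surjective φ)) := by
  constructor
  · rintro ⟨f, hf⟩
    let φ := ((f : MonoidAlgebra ℚ G →* Matrix (Fin 2) (Fin 2) ℚ).comp
      (MonoidAlgebra.of ℚ G)).toHomUnits
    let ρ := (Units.coeHom (Matrix (Fin 2) (Fin 2) ℚ)).comp φ.range.subtype
    have hρ : Function.Injective ρ := Units.val_injective.comp φ.range.subtype_injective
    have : Finite φ.range := Finite.of_surjective _ φ.rangeRestrict_surjective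
    obtain ⟨g, h, hgh⟩ := exists_not_commute_of_surjective hf
    have hcomm : ∃ g h : φ.range, g * h ≠ h * g :=
      ⟨φ.rangeRestrict g, φ.rangeRestrict h, fun heq ↦ hgh (congrArg ρ heq)⟩
    obtain ⟨e⟩ := DihedralGroup.mulEquiv_perm_fin_three
    rcases nonempty_dihedralGroup_mulEquiv hρ hcomm with ⟨⟨i⟩⟩ | ⟨⟨i⟩⟩ | ⟨⟨i⟩⟩
    · exact .inr ⟨(i.symm.trans e).toMonoidHom.comp φ.rangeRestrict,
        (i.symm.trans e).surjective.comp φ.rangeRestrict_surjective⟩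
    · exact .inl ⟨i.symm.toMonoidHom.comp φ.rangeRestrict,
        i.symm.surjective.comp φ.rangeRestrict_surjective⟩
    · obtain ⟨p, hp⟩ := DihedralGroup.exists_surjective_six_three
      exact .inr ⟨(e.toMonoidHom.comp (p.comp i.symm.toMonoidHom)).comp φ.rangeRestrict,
        (e.surjective.comp (hp.comp i.symm.surjective)).comp φ.rangeRestrict_surjective⟩
  · rintro (⟨φ, hφ⟩ | ⟨φ, hφ⟩)
    · exact exists_surjective_algHom_of_dihedralGroup_four φ hφ
    · obtain ⟨e⟩ := DihedralGroup.mulEquiv_perm_fin_three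
      exact exists_surjective_algHom_of_dihedralGroup_three (e.symm.toMonoidHom.comp φ)
        (e.symm.surjective.comp hφ)
end

section
/- The group SL₂(ℤ[i]) of 2×2 matrices of determinant 1 over the Gaussian integers has a nontrivial decomposition as a free product with amalgamation whose amalgamated subgroup is isomorphic to SL₂(ℤ); that is, there exist groups A and B, injective non-surjective group homomorphisms f : SL₂(ℤ) → A and g : SL₂(ℤ) → B, and a group isomorphism between SL₂(ℤ[i]) and the amalgamated free product A ∗_{SL₂(ℤ)} B (the pushout of f and g). -/
open Matrix Monoid

/-- Every element of an amalgamated product is the product of an element of the base group and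
a reduced word. -/
theorem Monoid.PushoutI.exists_reduced {ι : Type*} {G : ι → Type*} {H : Type*} [∀ i, Group (G i)]
    [Group H] {φ : ∀ i, H →* G i} (hφ : ∀ i, Function.Injective (φ i)) (x : PushoutI φ) :
    ∃ (h : H) (w : CoprodI.Word G), PushoutI.Reduced φ w ∧
      x = PushoutI.base φ h * PushoutI.ofCoprodI w.prod := by
  classical
  obtain ⟨d⟩ := PushoutI.NormalWord.transversal_nonempty φ hφ
  obtain ⟨w, rfl⟩ := (PushoutI.NormalWord.equiv (d := d)).symm.surjective x
  refine ⟨w.head, w.toWord, fun g hg hr => ?_, rfl⟩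
  have hset := w.normalized g.1 g.2 hg
  refine w.ne_one g hg ?_
  have := (d.compl g.1).1 (a₁ := (⟨g.2, hr⟩, ⟨1, d.one_mem g.1⟩)) (a₂ := (1, ⟨g.2, hset⟩))
    (by simp)
  simpa using (congrArg (fun p => (p.1 : G g.1)) this)

namespace GaussianSL2

/-- The group `SL₂(ℤ[i])`. -/
abbrev SLGauss : Type := SpecialLinearGroup (Fin 2) GaussianInt

/-- The inclusion `SL₂(ℤ) → SL₂(ℤ[i])`. -/
def ofInt : SpecialLinearGroup (Fin 2) ℤ →* SLGauss :=
  SpecialLinearGroup.map (Int.castRingHom GaussianInt)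

theorem ofInt_apply (c : SpecialLinearGroup (Fin 2) ℤ) (i j : Fin 2) :
    (ofInt c).1 i j = ((c.1 i j : ℤ) : GaussianInt) := rfl

theorem ofInt_injective : Function.Injective ofInt := by
  intro a b h
  ext i j
  have := congrArg (fun g : SLGauss => (g.1 i j).re) h
  simpa [ofInt_apply] using this

/-- The left action of `SL₂(ℤ[i])` on functions of row vectors. -/
def translate (g : SLGauss) (u : (Fin 2 → GaussianInt) → ℤ) : (Fin 2 → GaussianInt) → ℤ :=
  fun z => u (z ᵥ* g.1)

theorem translate_neg (g : SLGauss) (u : (Fin 2 → GaussianInt) → ℤ) :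
    translate g (-u) = -translate g u := rfl

theorem translate_inv_translate (g : SLGauss) (u : (Fin 2 → GaussianInt) → ℤ) :
    translate g⁻¹ (translate g u) = u := by
  have h : (g⁻¹).1 * g.1 = 1 := congrArg Subtype.val (inv_mul_cancel g)
  funext z
  rw [translate, translate, vecMul_vecMul, h, vecMul_one]

theorem translate_mono (g : SLGauss) : Monotone (translate g) := fun _ _ h _ => h _

theorem translate_strictMono (g : SLGauss) : StrictMono (translate g) :=
  (translate_mono g).strictMono_of_injective
    (Function.LeftInverse.injective (translate_inv_translate g))

/-- The translate by `g` of the form `z ↦ Im (z₀ z̄₁)` on row vectors. -/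
def form (g : SLGauss) (z : Fin 2 → GaussianInt) : ℤ :=
  ((z ᵥ* g.1) 0 * star ((z ᵥ* g.1) 1)).im

theorem form_one (z : Fin 2 → GaussianInt) : form 1 z = (z 0 * star (z 1)).im := by
  simp [form]

theorem form_mul (g h : SLGauss) : form (g * h) = translate g (form h) := by
  funext z
  simp [form, translate, vecMul_vecMul]

theorem translate_form_one (g : SLGauss) : translate g (form 1) = form g := by
  rw [← form_mul, mul_one]

theorem form_neg (g : SLGauss) : form (-g) = form g := by
  funext z
  simp [form, vecMul_neg]

/-- The off-diagonal coefficient of `form g`. -/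
def offDiag (g : SLGauss) : GaussianInt :=
  g.1 0 0 * star (g.1 1 1) - g.1 0 1 * star (g.1 1 0)

theorem form_apply (g : SLGauss) (z : Fin 2 → GaussianInt) :
    form g z = form g ![1, 0] * (z 0).norm + form g ![0, 1] * (z 1).norm +
      (z 0 * star (z 1) * offDiag g).im := by
  simp [form, offDiag, vecMul, dotProduct, Fin.sum_univ_two, Zsqrtd.norm]
  ring

theorem exists_re_offDiag_eq (g : SLGauss) : ∃ n, (offDiag g).re = 1 + 2 * n := by
  refine ⟨(g.1 0 0).im * (g.1 1 1).im - (g.1 0 1).im * (g.1 1 0).im, ?_⟩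
  have h := congrArg Zsqrtd.re (det_fin_two g.1 ▸ g.2)
  simp [offDiag] at h ⊢
  linarith

theorem offDiag_sq (g : SLGauss) :
    (offDiag g).re ^ 2 + (offDiag g).im ^ 2 = 4 * (form g ![1, 0] * form g ![0, 1]) + 1 := by
  have hd := det_fin_two g.1 ▸ g.2
  have h := congrArg Zsqrtd.re hd
  have h' := congrArg Zsqrtd.im hd
  set p := g.1 0 0 with hp
  set q := g.1 0 1 with hq
  set r := g.1 1 0 with hr
  set s := g.1 1 1 with hs
  simp [offDiag, form, vecMul, dotProduct, Fin.sum_univ_two, ← hp, ← hq, ← hr, ← hs] at h h' ⊢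
  linear_combination
    (p.re * s.re - p.im * s.im - (q.re * r.re - q.im * r.im) + 1) * h +
    (p.re * s.im + p.im * s.re - (q.re * r.im + q.im * r.re)) * h'

theorem hermitian_nonneg {x y : ℤ} (hx : 0 ≤ x) (hy : 0 ≤ y) {w : GaussianInt}
    (hw : w.re ^ 2 + w.im ^ 2 ≤ 4 * (x * y)) (u v : GaussianInt) :
    0 ≤ x * u.norm + y * v.norm + (u * star v * w).im := by
  have hu := GaussianInt.norm_nonneg u
  have hv := GaussianInt.norm_nonneg v
  have h0 : 0 ≤ x * u.norm + y * v.norm := by positivity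
  have hsq : (u * star v * w).im ^ 2 ≤ (x * u.norm + y * v.norm) ^ 2 := by
    calc (u * star v * w).im ^ 2
        ≤ (u * star v * w).re ^ 2 + (u * star v * w).im ^ 2 := by nlinarith
      _ = u.norm * v.norm * (w.re ^ 2 + w.im ^ 2) := by
          simp [Zsqrtd.norm]; ring
      _ ≤ u.norm * v.norm * (4 * (x * y)) := by gcongr
      _ ≤ _ := by nlinarith [sq_nonneg (x * u.norm - y * v.norm)]
  linarith [(abs_le.1 (abs_le_of_sq_le_sq hsq h0)).1]

theorem eq_zero_of_odd_sq_add_sq_eq_one {n k : ℤ} (h : (1 + 2 * n) ^ 2 + k ^ 2 = 1) :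
    k = 0 ∧ (n = 0 ∨ n = -1) := by
  have hn : 0 ≤ n * (n + 1) := by
    rcases le_or_gt 0 n with hn | hn <;> nlinarith
  have hk : k = 0 := pow_eq_zero_iff two_ne_zero |>.1 (le_antisymm (by linarith) (sq_nonneg k))
  refine ⟨hk, ?_⟩
  subst hk
  rcases mul_eq_zero.1 (show n * (n + 1) = 0 by linarith) with h | h
  · exact Or.inl h
  · exact Or.inr (by linarith)

theorem form_eq_form_one_of {g : SLGauss} (hx : form g ![1, 0] = 0) (hy : form g ![0, 1] = 0)
    (hw : offDiag g = 1) : form g = form 1 := by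
  funext z
  rw [form_apply, hx, hy, hw, form_one]
  simp

theorem form_eq_neg_form_one_of {g : SLGauss} (hx : form g ![1, 0] = 0)
    (hy : form g ![0, 1] = 0) (hw : offDiag g = -1) : form g = -form 1 := by
  funext z
  rw [form_apply, hx, hy, hw, Pi.neg_apply, form_one]
  simp

theorem offDiag_eq_of_form_eq {g h : SLGauss} (e : form g = form h) : offDiag g = offDiag h := by
  have h1 := form_apply g ![1, 1]
  have h2 := form_apply h ![1, 1]
  have h3 := form_apply g ![⟨0, 1⟩, 1]
  have h4 := form_apply h ![⟨0, 1⟩, 1]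
  rw [e] at h1 h3
  ext
  · simp at h3 h4; linarith
  · simp at h1 h2; linarith

theorem mem_range_of_form_eq {g : SLGauss} (h : form g = form 1) : g ∈ ofInt.range := by
  have hw := offDiag_eq_of_form_eq h
  have hw' := congrArg star hw
  have hx : g.1 0 0 * star (g.1 0 1) = star (g.1 0 0) * g.1 0 1 := by
    have := congrFun h ![1, 0]
    simp [form, vecMul, dotProduct, Fin.sum_univ_two] at this
    ext
    · simp
    · simp; linarith
  have hy : g.1 1 0 * star (g.1 1 1) = star (g.1 1 0) * g.1 1 1 := by
    have := congrFun h ![0, 1]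
    simp [form, vecMul, dotProduct, Fin.sum_univ_two] at this
    ext
    · simp
    · simp; linarith
  have hd := det_fin_two g.1 ▸ g.2
  simp [offDiag] at hw hw'
  have hstar : ∀ i j, star (g.1 i j) = g.1 i j := by
    intro i j
    fin_cases i <;> fin_cases j <;> dsimp only [Fin.zero_eta, Fin.mk_one, Fin.isValue]
    · linear_combination -star (g.1 0 0) * hd + g.1 0 0 * hw' + g.1 1 0 * hx
    · linear_combination -star (g.1 0 1) * hd + g.1 0 1 * hw' + g.1 1 1 * hx
    · linear_combination -star (g.1 1 0) * hd + g.1 1 0 * hw - g.1 0 0 * hy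
    · linear_combination -star (g.1 1 1) * hd + g.1 1 1 * hw - g.1 0 1 * hy
  have h_int : ∀ i j, g.1 i j = (((g.1 i j).re : ℤ) : GaussianInt) := by
    intro i j
    have := congrArg Zsqrtd.im (hstar i j)
    simp at this
    ext
    · simp
    · simp; lia
  refine ⟨⟨g.1.map Zsqrtd.re, ?_⟩, ?_⟩
  · have : ((g.1.map Zsqrtd.re).det : GaussianInt) = 1 := by
      rw [det_fin_two]
      simp only [map_apply]
      push_cast
      simp only [← h_int]
      exact hd
    exact_mod_cast this
  · ext1 i j
    exact (h_int i j).symm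

theorem form_ofInt (c : SpecialLinearGroup (Fin 2) ℤ) : form (ofInt c) = form 1 := by
  have hd := det_fin_two c.1 ▸ c.2
  funext z
  rw [form_one]
  simp [form, ofInt_apply, vecMul, dotProduct, Fin.sum_univ_two]
  linear_combination ((z 0).im * (z 1).re - (z 0).re * (z 1).im) * hd

theorem form_one_not_le_neg : ¬ form 1 ≤ -form 1 := fun h => by
  simpa [form_one] using h ![⟨0, 1⟩, 1]

theorem neg_form_one_not_le : ¬ -form 1 ≤ form 1 := fun h => by
  simpa [form_one] using h ![1, ⟨0, 1⟩]

/-- The set of translates of the upper half-plane, seen as oriented edges of a tree, that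
point towards a fixed vertex. -/
def star₀ : Set SLGauss :=
  {g | 0 ≤ form g ![1, 0] ∧ 0 ≤ form g ![0, 1] ∧ form g ≠ -form 1}

/-- The stabilizer of a vertex of the tree. -/
def vertexStabilizer : Subgroup SLGauss where
  carrier := {g | ∀ k, g * k ∈ star₀ ↔ k ∈ star₀}
  one_mem' := by simp
  mul_mem' {a b} ha hb k := by rw [mul_assoc, ha, hb]
  inv_mem' {a} ha k := by rw [← ha, mul_inv_cancel_left]

/-- The stabilizer of an unoriented edge of the tree. -/
def edgeStabilizer : Subgroup SLGauss where
  carrier := {g | form g = form 1 ∨ form g = -form 1}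
  one_mem' := Or.inl rfl
  mul_mem' {a b} ha hb := by
    simp only [Set.mem_ofPred_eq, form_mul] at *
    rcases hb with hb | hb <;> rcases ha with ha | ha <;>
      simp [hb, translate_neg, translate_form_one, ha]
  inv_mem' {a} ha := by
    have h := translate_inv_translate a (form 1)
    simp only [Set.mem_ofPred_eq] at *
    rw [translate_form_one] at h
    rcases ha with ha | ha
    · rw [ha, translate_form_one] at h
      exact Or.inl h
    · rw [ha, translate_neg, translate_form_one] at h
      exact Or.inr (neg_eq_iff_eq_neg.1 h)

theorem ofInt_mem_edgeStabilizer (c : SpecialLinearGroup (Fin 2) ℤ) :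
    ofInt c ∈ edgeStabilizer := Or.inl (form_ofInt c)

theorem form_eq_neg_of_mem_edgeStabilizer {g : SLGauss} (hg : g ∈ edgeStabilizer)
    (h : g ∉ ofInt.range) : form g = -form 1 :=
  hg.resolve_left fun e => h (mem_range_of_form_eq e)

theorem ofInt_mul_mem_star₀ (c : SpecialLinearGroup (Fin 2) ℤ) {k : SLGauss} (hk : k ∈ star₀) :
    ofInt c * k ∈ star₀ := by
  obtain ⟨hx, hy, hne⟩ := hk
  obtain ⟨n, hn⟩ := exists_re_offDiag_eq k
  have hsq := offDiag_sq k
  have key : ∀ a b : ℤ, 0 ≤ form k ![(a : GaussianInt), (b : GaussianInt)] := by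
    intro a b
    have := hermitian_nonneg hx hy (w := ⟨0, (offDiag k).im⟩)
      (by simp only; nlinarith [mul_self_nonneg n, Int.le_self_sq n, Int.le_self_sq (-n)]) a b
    rw [form_apply]
    simpa using this
  refine ⟨?_, ?_, fun h => hne ?_⟩
  · rw [form_mul]
    convert key (c.1 0 0) (c.1 0 1) using 1
    refine congrArg (form k) ?_
    ext i : 1
    fin_cases i <;> simp [ofInt_apply, vecMul, dotProduct, Fin.sum_univ_two]
  · rw [form_mul]
    convert key (c.1 1 0) (c.1 1 1) using 1
    refine congrArg (form k) ?_
    ext i : 1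
    fin_cases i <;> simp [ofInt_apply, vecMul, dotProduct, Fin.sum_univ_two]
  · rw [← translate_inv_translate (ofInt c) (form k), ← form_mul, h, translate_neg,
      translate_form_one, ← map_inv, form_ofInt]

theorem ofInt_mem_vertexStabilizer (c : SpecialLinearGroup (Fin 2) ℤ) :
    ofInt c ∈ vertexStabilizer := fun k =>
  ⟨fun h => by simpa [← mul_assoc, ← map_mul] using ofInt_mul_mem_star₀ c⁻¹ h,
    ofInt_mul_mem_star₀ c⟩

/-- The half-turn `z ↦ i - z`. -/
def halfTurn : SLGauss := ⟨!![⟨0, 1⟩, 1; 0, ⟨0, -1⟩], by rw [det_fin_two]; rfl⟩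

/-- The rotation `z ↦ -z`. -/
def rotation : SLGauss := ⟨!![⟨0, 1⟩, 0; 0, ⟨0, -1⟩], by rw [det_fin_two]; rfl⟩

theorem halfTurn_mul_halfTurn : halfTurn * halfTurn = -1 := by
  refine Subtype.ext (show halfTurn.1 * halfTurn.1 = -1 from ?_)
  simp only [halfTurn]
  decide

theorem rotation_mem_edgeStabilizer : rotation ∈ edgeStabilizer := by
  refine Or.inr (form_eq_neg_form_one_of ?_ ?_ ?_)
  · simp [form, rotation]
  · simp [form, rotation]
  · ext <;> simp [offDiag, rotation]

theorem rotation_mul_rotation : rotation * rotation = -1 := by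
  refine Subtype.ext (show rotation.1 * rotation.1 = -1 from ?_)
  simp only [rotation]
  decide

theorem neg_mem_star₀ {k : SLGauss} (h : -k ∈ star₀) : k ∈ star₀ := by
  simpa only [star₀, Set.mem_ofPred_eq, form_neg] using h

theorem halfTurn_mul_mem_star₀ {k : SLGauss} (hk : k ∈ star₀) : halfTurn * k ∈ star₀ := by
  obtain ⟨hx, hy, hne⟩ := hk
  obtain ⟨n, hn⟩ := exists_re_offDiag_eq k
  have hsq := offDiag_sq k
  have hx' : form (halfTurn * k) ![1, 0] =
      form k ![1, 0] + form k ![0, 1] + (offDiag k).re := by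
    rw [form_mul, translate, form_apply]
    simp [halfTurn, Zsqrtd.norm, vecMul, dotProduct, Fin.sum_univ_two]
  have hy' : form (halfTurn * k) ![0, 1] = form k ![0, 1] := by
    rw [form_mul, translate, form_apply]
    simp [halfTurn, Zsqrtd.norm, vecMul, dotProduct, Fin.sum_univ_two]
  refine ⟨?_, hy'.symm ▸ hy, fun e => ?_⟩
  · rw [hx']
    rcases hy.eq_or_lt with hy0 | hy0
    · rw [← hy0, hn] at hsq
      obtain ⟨hk0, rfl | rfl⟩ := eq_zero_of_odd_sq_add_sq_eq_one (hsq.trans (by ring))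
      · lia
      · rcases hx.eq_or_lt with hx0 | hx0
        · refine absurd (form_eq_neg_form_one_of hx0.symm hy0.symm ?_) hne
          ext <;> simp [hn, hk0]
        · lia
    · nlinarith [sq_nonneg (form k ![1, 0] - form k ![0, 1]), sq_nonneg (offDiag k).im]
  · have h := form_neg k
    rw [← neg_one_mul, ← halfTurn_mul_halfTurn, mul_assoc, form_mul, e, translate_neg,
      translate_form_one] at h
    have := congrFun h ![1, 0]
    simp [form, halfTurn] at this hx
    lia

theorem halfTurn_mem_vertexStabilizer : halfTurn ∈ vertexStabilizer := fun k =>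
  ⟨fun h => by
    have := halfTurn_mul_mem_star₀ h
    rw [← mul_assoc, halfTurn_mul_halfTurn, neg_one_mul] at this
    exact neg_mem_star₀ this, halfTurn_mul_mem_star₀⟩

theorem neg_form_lt_of_mem_vertexStabilizer {a : SLGauss} (ha : a ∈ vertexStabilizer)
    (h : a ∉ ofInt.range) : -form a < form 1 := by
  have one_mem : (1 : SLGauss) ∈ star₀ := by
    refine ⟨by simp [form_one], by simp [form_one], fun e => form_one_not_le_neg e.le⟩
  obtain ⟨hx, hy, hne⟩ : a ∈ star₀ := by simpa using (ha 1).2 one_mem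
  obtain ⟨hx', hy', hne'⟩ : a⁻¹ ∈ star₀ := by simpa using (inv_mem ha 1).2 one_mem
  have hsq := offDiag_sq a
  obtain ⟨n, hn⟩ := exists_re_offDiag_eq a
  obtain hpos | hneg : 0 ≤ n ∨ n < 0 := le_or_gt 0 n
  · exfalso
    have hle : form 1 ≤ form a := by
      intro z
      have := hermitian_nonneg hx hy (w := offDiag a - 1) (by simp; nlinarith) (z 0) (z 1)
      rw [mul_sub] at this
      simp at this
      rw [form_apply a, form_one]
      simp
      linarith
    have hle' : form a⁻¹ ≤ form 1 := by
      rw [← translate_form_one a⁻¹]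
      refine (translate_mono _ hle).trans_eq ?_
      rw [← translate_form_one a, translate_inv_translate]
    have e1 : form a⁻¹ ![1, 0] = 0 := le_antisymm (by simpa [form_one] using hle' ![1, 0]) hx'
    have e2 : form a⁻¹ ![0, 1] = 0 := le_antisymm (by simpa [form_one] using hle' ![0, 1]) hy'
    have hsq' := offDiag_sq a⁻¹
    obtain ⟨m, hm⟩ := exists_re_offDiag_eq a⁻¹
    rw [e1, e2] at hsq'
    rw [hm] at hsq'
    obtain ⟨him, rfl | rfl⟩ := eq_zero_of_odd_sq_add_sq_eq_one (hsq'.trans (by ring))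
    · refine h ?_
      rw [← inv_mem_iff]
      refine mem_range_of_form_eq (form_eq_form_one_of e1 e2 ?_)
      ext <;> simp [hm, him]
    · refine hne' (form_eq_neg_form_one_of e1 e2 ?_)
      ext <;> simp [hm, him]
  · refine lt_of_le_of_ne (fun z => ?_) fun e => hne (neg_eq_iff_eq_neg.1 e)
    have := hermitian_nonneg hx hy (w := offDiag a + 1) (by simp; nlinarith) (z 0) (z 1)
    rw [mul_add] at this
    simp at this
    rw [Pi.neg_apply, form_apply a, form_one]
    simp
    linarith

/-- The two factors of the amalgamated product. -/
def factor : Bool → Subgroup SLGauss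
  | true => vertexStabilizer
  | false => edgeStabilizer

theorem ofInt_mem_factor : ∀ b c, ofInt c ∈ factor b
  | true => ofInt_mem_vertexStabilizer
  | false => ofInt_mem_edgeStabilizer

/-- The inclusion of `SL₂(ℤ)` into a factor. -/
def toFactor (b : Bool) : SpecialLinearGroup (Fin 2) ℤ →* factor b :=
  ofInt.codRestrict (factor b) (ofInt_mem_factor b)

theorem toFactor_injective (b : Bool) : Function.Injective (toFactor b) := fun _ _ h =>
  ofInt_injective (congrArg Subtype.val h)

theorem notMem_range_ofInt {b : Bool} {g : factor b} (h : g ∉ (toFactor b).range) :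
    g.1 ∉ ofInt.range := fun ⟨c, hc⟩ => h ⟨c, Subtype.ext hc⟩

theorem not_surjective_toFactor (b : Bool) : ¬ Function.Surjective (toFactor b) := by
  intro h
  have key : ∀ g ∈ factor b, (g.1 0 0).im = 0 := by
    intro g hg
    obtain ⟨c, hc⟩ := h ⟨g, hg⟩
    obtain rfl : ofInt c = g := congrArg Subtype.val hc
    simp [ofInt_apply]
  cases b
  · simpa [rotation] using key rotation rotation_mem_edgeStabilizer
  · simpa [halfTurn] using key halfTurn halfTurn_mem_vertexStabilizer

theorem subtype_comp_toFactor (b : Bool) : (factor b).subtype.comp (toFactor b) = ofInt := rfl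

/-- The canonical map from the amalgamated product to `SL₂(ℤ[i])`. -/
def amalgamHom : PushoutI toFactor →* SLGauss :=
  PushoutI.lift (fun b => (factor b).subtype) ofInt subtype_comp_toFactor

theorem amalgamHom_of (b : Bool) (g : factor b) : amalgamHom (PushoutI.of b g) = g :=
  PushoutI.lift_of ..

theorem amalgamHom_base (c : SpecialLinearGroup (Fin 2) ℤ) :
    amalgamHom (PushoutI.base toFactor c) = ofInt c :=
  PushoutI.lift_base ..

/-- The region to which a reduced word with first letter in `factor b` moves the base edge. -/
def PingPong : Bool → SLGauss → Prop
  | true, g => form g < form 1 ∨ -form g < form 1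
  | false, g => form g = -form 1 ∨ form g < -form 1 ∨ -form g < -form 1

theorem PingPong.form_ne {b : Bool} {g : SLGauss} (h : PingPong b g) : form g ≠ form 1 := by
  intro e
  cases b
  · simp only [PingPong, e, lt_irrefl, or_false] at h
    exact form_one_not_le_neg (h.elim le_of_eq le_of_lt)
  · simp only [PingPong, e, lt_irrefl, false_or] at h
    exact neg_form_one_not_le h.le

theorem pingPong_of_notMem_range {b : Bool} {g : factor b} (h : g ∉ (toFactor b).range) :
    PingPong b g := by
  cases b
  · exact Or.inl (form_eq_neg_of_mem_edgeStabilizer g.2 (notMem_range_ofInt h))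
  · exact Or.inr (neg_form_lt_of_mem_vertexStabilizer g.2 (notMem_range_ofInt h))

theorem PingPong.mul {b : Bool} {a : factor b} (ha : a ∉ (toFactor b).range) {g : SLGauss}
    (hg : PingPong (!b) g) : PingPong b (a * g) := by
  have ha' := notMem_range_ofInt ha
  cases b
  · have e : translate a.1 (form 1) = -form 1 := by
      rw [translate_form_one, form_eq_neg_of_mem_edgeStabilizer a.2 ha']
    refine Or.inr (Or.imp (fun h => ?_) (fun h => ?_) hg)
    · rw [form_mul, ← e]
      exact translate_strictMono _ h
    · rw [form_mul, ← translate_neg, ← e]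
      exact translate_strictMono _ h
  · have hlt : translate a.1 (-form 1) < form 1 := by
      rw [translate_neg, translate_form_one]
      exact neg_form_lt_of_mem_vertexStabilizer a.2 ha'
    rcases hg with h | h | h
    · exact Or.inl (by rwa [form_mul, h])
    · exact Or.inl ((form_mul a.1 g).trans_lt ((translate_strictMono _ h).trans hlt))
    · refine Or.inr ?_
      rw [form_mul, ← translate_neg]
      exact (translate_strictMono _ h).trans hlt

theorem pingPong_of_reduced {w : CoprodI.Word fun b => factor b}
    (hw : PushoutI.Reduced toFactor w) : w = CoprodI.Word.empty ∨
      ∃ b, w.fstIdx = some b ∧ PingPong b (amalgamHom (PushoutI.ofCoprodI w.prod)) := by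
  induction w using CoprodI.Word.consRecOn with
  | empty => exact Or.inl rfl
  | cons b a w h1 h2 ih =>
    have ha : a ∉ (toFactor b).range := hw ⟨b, a⟩ List.mem_cons_self
    refine Or.inr ⟨b, CoprodI.Word.fstIdx_cons .., ?_⟩
    rw [CoprodI.Word.prod_cons, map_mul, PushoutI.ofCoprodI_of, map_mul, amalgamHom_of]
    rcases ih fun g hg => hw g (List.mem_cons_of_mem _ hg) with rfl | ⟨b', hb', h⟩
    · simpa using pingPong_of_notMem_range ha
    · obtain rfl : b' = !b := by
        rw [hb'] at h1
        cases b <;> cases b' <;> simp_all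
      exact h.mul ha

theorem amalgamHom_injective : Function.Injective amalgamHom := by
  rw [injective_iff_map_eq_one]
  intro x hx
  obtain ⟨c, w, hw, rfl⟩ := PushoutI.exists_reduced toFactor_injective x
  rcases pingPong_of_reduced hw with rfl | ⟨b, -, h⟩
  · simp only [CoprodI.Word.prod_empty, map_one, mul_one, amalgamHom_base] at hx ⊢
    rw [(injective_iff_map_eq_one ofInt).1 ofInt_injective c hx, map_one]
  · refine absurd ?_ h.form_ne
    rw [map_mul, amalgamHom_base, mul_eq_one_iff_inv_eq, ← map_inv] at hx
    rw [← hx, form_ofInt]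

/-- Upper unitriangular matrices. -/
def upper (t : GaussianInt) : SLGauss := ⟨!![1, t; 0, 1], by simp [det_fin_two]⟩

theorem upper_add (s t : GaussianInt) : upper (s + t) = upper s * upper t := by
  refine Subtype.ext (show (upper (s + t)).1 = (upper s).1 * (upper t).1 from ?_)
  simp [upper, add_comm]

theorem upper_intCast (n : ℤ) : upper n = ofInt ⟨!![1, n; 0, 1], by simp [det_fin_two]⟩ := by
  ext1 i j
  refine Eq.trans ?_ (ofInt_apply _ i j).symm
  fin_cases i <;> fin_cases j <;> simp [upper]

theorem rotation_mul_upper : rotation * upper ⟨0, -1⟩ = halfTurn := by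
  refine Subtype.ext (show rotation.1 * (upper ⟨0, -1⟩).1 = halfTurn.1 from ?_)
  simp only [rotation, upper, halfTurn]
  decide

theorem upper_mem {K : Subgroup SLGauss} (h_int : ∀ c, ofInt c ∈ K)
    (hrot : rotation ∈ K) (hhalf : halfTurn ∈ K) (t : GaussianInt) : upper t ∈ K := by
  let U : GaussianInt →+ Additive SLGauss :=
    AddMonoidHom.mk' (fun t => Additive.ofMul (upper t)) upper_add
  let L : AddSubgroup GaussianInt := (Subgroup.toAddSubgroup K).comap U
  have hcast : ∀ n : ℤ, (n : GaussianInt) ∈ L := fun n => by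
    change upper n ∈ K
    rw [upper_intCast]
    exact h_int _
  have hi : (⟨0, -1⟩ : GaussianInt) ∈ L := by
    change upper ⟨0, -1⟩ ∈ K
    rw [← K.mul_mem_cancel_left hrot, rotation_mul_upper]
    exact hhalf
  have ht : t = t.re + -t.im • (⟨0, -1⟩ : GaussianInt) := by
    ext <;> simp
  change t ∈ L
  rw [ht]
  exact add_mem (hcast _) (zsmul_mem hi _)

theorem mem_of_lower_left_eq_zero {K : Subgroup SLGauss} (h_int : ∀ c, ofInt c ∈ K)
    (hrot : rotation ∈ K) (hhalf : halfTurn ∈ K) {g : SLGauss} (hg : g.1 1 0 = 0) : g ∈ K := by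
  have hd := det_fin_two g.1 ▸ g.2
  rw [hg, mul_zero, sub_zero] at hd
  have key : ∀ h ∈ K, (h.1 1 0 = 0) → h.1 0 0 = g.1 0 0 → g ∈ K := by
    intro h hh h10 h00
    have hd' := det_fin_two h.1 ▸ h.2
    rw [h10, mul_zero, sub_zero, h00] at hd'
    have h11 : h.1 1 1 = g.1 1 1 := by
      linear_combination g.1 1 1 * hd' - h.1 1 1 * hd
    have e : g = h * upper (g.1 1 1 * (g.1 0 1 - h.1 0 1)) := by
      refine Subtype.ext
        (show g.1 = h.1 * (upper (g.1 1 1 * (g.1 0 1 - h.1 0 1))).1 from ?_)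
      ext1 i j
      fin_cases i <;> fin_cases j <;>
        simp [mul_apply, Fin.sum_univ_two, upper, h10, h00, h11, hg]
      linear_combination (h.1 0 1 - g.1 0 1) * hd
    rw [e]
    exact mul_mem hh (upper_mem h_int hrot hhalf _)
  have hnorm := (Zsqrtd.norm_eq_one_iff' (by norm_num) (g.1 0 0)).2 (IsUnit.of_mul_eq_one _ hd)
  have hsq : (g.1 0 0).re ^ 2 + (g.1 0 0).im ^ 2 = 1 := by
    rw [Zsqrtd.norm] at hnorm
    linarith
  have hneg : (-1 : SLGauss) ∈ K := by
    rw [← rotation_mul_rotation]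
    exact mul_mem hrot hrot
  have hcases : g.1 0 0 = 1 ∨ g.1 0 0 = -1 ∨ g.1 0 0 = ⟨0, 1⟩ ∨ g.1 0 0 = ⟨0, -1⟩ := by
    have hre : |(g.1 0 0).re| ≤ 1 := abs_le_of_sq_le_sq (by nlinarith) one_pos.le
    have him : |(g.1 0 0).im| ≤ 1 := abs_le_of_sq_le_sq (by nlinarith) one_pos.le
    rw [abs_le] at hre him
    simp only [Zsqrtd.ext_iff]
    generalize (g.1 0 0).re = a at *
    generalize (g.1 0 0).im = b at *
    obtain ⟨h1, h2⟩ := hre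
    obtain ⟨h3, h4⟩ := him
    interval_cases a <;> interval_cases b <;> simp at hsq ⊢
  rcases hcases with h | h | h | h
  · exact key 1 (one_mem K) (by simp) (by simp [h])
  · exact key (-1) hneg (by simp) (by simp [h])
  · exact key rotation hrot (by simp [rotation]) (by simp [h, rotation])
  · exact key (-rotation) (neg_one_mul rotation ▸ mul_mem hneg hrot)
      (show (-rotation.1) 1 0 = 0 by simp [rotation])
      (show (-rotation.1) 0 0 = g.1 0 0 by rw [h]; simp [rotation]; rfl)

theorem mem_of_generators {K : Subgroup SLGauss} (h_int : ∀ c, ofInt c ∈ K)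
    (hrot : rotation ∈ K) (hhalf : halfTurn ∈ K) (g : SLGauss) : g ∈ K := by
  induction hn : (g.1 1 0).norm.natAbs using Nat.strong_induction_on generalizing g with
  | _ n ih =>
    by_cases hr : g.1 1 0 = 0
    · exact mem_of_lower_left_eq_zero h_int hrot hhalf hr
    · have hS := h_int ModularGroup.S
      have hU := upper_mem h_int hrot hhalf (-(g.1 0 0 / g.1 1 0))
      rw [← K.mul_mem_cancel_left hU, ← K.mul_mem_cancel_left hS]
      refine ih _ ?_ _ rfl
      have e : (ofInt ModularGroup.S * (upper (-(g.1 0 0 / g.1 1 0)) * g)).1 1 0 =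
          g.1 0 0 % g.1 1 0 := by
        change ((ofInt ModularGroup.S).1 * ((upper (-(g.1 0 0 / g.1 1 0))).1 * g.1)) 1 0 = _
        have h0 : (ofInt ModularGroup.S).1 1 0 = 1 :=
          (ofInt_apply _ _ _).trans (by simp [ModularGroup.S])
        have h1 : (ofInt ModularGroup.S).1 1 1 = 0 :=
          (ofInt_apply _ _ _).trans (by simp [ModularGroup.S])
        rw [mul_apply, Fin.sum_univ_two, h0, h1, GaussianInt.mod_def]
        simp [upper, vecMul, dotProduct, Fin.sum_univ_two]
        ring
      rw [e, ← hn]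
      exact GaussianInt.natAbs_norm_mod_lt _ hr

theorem amalgamHom_surjective : Function.Surjective amalgamHom := by
  have hof : ∀ b (g : factor b), g.1 ∈ amalgamHom.range := fun b g =>
    ⟨PushoutI.of b g, amalgamHom_of ..⟩
  exact fun g => mem_of_generators (K := amalgamHom.range)
    (fun c => hof true (toFactor true c)) (hof false ⟨_, rotation_mem_edgeStabilizer⟩)
    (hof true ⟨_, halfTurn_mem_vertexStabilizer⟩) g

end GaussianSL2

/-- `SL₂(ℤ[i])` is a nontrivial amalgamated product with amalgamated subgroup `SL₂(ℤ)`. -/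
theorem SL2_gaussianInt_amalgam_over_SL2Z :
    ∃ (Gf : Bool → Type) (_ : ∀ b, Group (Gf b))
      (φ : ∀ b, Matrix.SpecialLinearGroup (Fin 2) ℤ →* Gf b),
        (∀ b, Function.Injective (φ b)) ∧ (∀ b, ¬ Function.Surjective (φ b)) ∧
        Nonempty (Matrix.SpecialLinearGroup (Fin 2) GaussianInt ≃* Monoid.PushoutI φ) := by
  exact ⟨fun b => GaussianSL2.factor b, inferInstance, GaussianSL2.toFactor,
    GaussianSL2.toFactor_injective, GaussianSL2.not_surjective_toFactor,
    ⟨(MulEquiv.ofBijective GaussianSL2.amalgamHom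
      ⟨GaussianSL2.amalgamHom_injective, GaussianSL2.amalgamHom_surjective⟩).symm⟩⟩
end
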